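/- For every c ≤ 1 the finite limit λ_c := lim_{t→+∞} (√(1 + t²) − f_c(t)) exists. Moreover λ_c < 0 if c < 0, λ_c > 0 if 0 < c < 1, and λ_1 < 0. -/

import Mathlib

open Real Filter

/-- A global spacelike solution: a `C²` function `f : ℝ → ℝ` with `|f'| < 1` and
`f'' = f^(n-1) (1 - f'^2)^((n+2)/2)` on all of `ℝ`. -/
def IsGSS (n : ℕ) (f : ℝ → ℝ) : Prop :=
  ContDiff ℝ 2 f ∧
  ∀ t : ℝ, |deriv f t| < 1 ∧
    deriv (deriv f) t = f t ^ (n - 1) * (1 - (deriv f t) ^ 2) ^ ((n + 2 : ℝ) / 2)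

/-- `IsFc n c f` says that `f` is the normalized global spacelike solution `f_c`:
for `c < 1` it satisfies `f 0 = (1-c)^(1/n)`, `f' 0 = 0` (so its first integral is `c`);
for `c = 1` it satisfies `f 0 = 1`, `f' 0 = √(1 - 2^(-2/n))` (first integral `1`,
and `f` is strictly increasing). -/
def IsFc (n : ℕ) (c : ℝ) (f : ℝ → ℝ) : Prop :=
  IsGSS n f ∧
  (c < 1 → f 0 = (1 - c) ^ ((1 : ℝ) / n) ∧ deriv f 0 = 0) ∧
  (c = 1 → f 0 = 1 ∧ deriv f 0 = Real.sqrt (1 - (2 : ℝ) ^ (-(2 : ℝ) / n)))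

/-- The first-order form of the equation for a spacelike solution `f` on `ℝ`, with exponent
`n = m + 1`, slope `g = f'`, Lorentz factor `w = (1 - g²)^(-1/2)` and first integral `c`,
positive and nondecreasing at time `0`. -/
structure SpacelikeFlow (m : ℕ) (c : ℝ) (f g w : ℝ → ℝ) : Prop where
  hasDerivAt_f : ∀ t, HasDerivAt f (g t) t
  hasDerivAt_g : ∀ t, HasDerivAt g (f t ^ m * (w t)⁻¹ ^ (m + 3)) t
  hasDerivAt_w : ∀ t, HasDerivAt w (g t * f t ^ m * (w t)⁻¹ ^ m) t
  w_pos : ∀ t, 0 < w t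
  w_sq : ∀ t, w t ^ 2 * (1 - g t ^ 2) = 1
  g_lt_one : ∀ t, g t < 1
  first_integral : ∀ t, w t ^ (m + 1) = f t ^ (m + 1) + c
  f_zero_pos : 0 < f 0
  g_zero_nonneg : 0 ≤ g 0

namespace SpacelikeFlow

variable {m : ℕ} {c : ℝ} {f g w : ℝ → ℝ}

lemma f_pos (h : SpacelikeFlow m c f g w) {t : ℝ} (ht : 0 ≤ t) : 0 < f t := by
  by_contra! hneg
  have hfc : Continuous f := continuous_iff_continuousAt.2 fun s => (h.hasDerivAt_f s).continuousAt
  have hgc : Continuous g := continuous_iff_continuousAt.2 fun s => (h.hasDerivAt_g s).continuousAt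
  have hcpt : IsCompact (Set.Icc 0 t ∩ {s | f s ≤ 0}) :=
    isCompact_Icc.inter_right (isClosed_le hfc continuous_const)
  obtain ⟨a, ⟨⟨ha0, hat⟩, hfa⟩, hmin⟩ := hcpt.exists_isLeast ⟨t, ⟨ht, le_rfl⟩, hneg⟩
  have hpos : ∀ s, 0 ≤ s → s < a → 0 < f s := fun s hs hsa => by
    by_contra! hs'
    exact absurd (hmin ⟨⟨hs, by linarith⟩, hs'⟩) (not_le.2 hsa)
  have hg : MonotoneOn g (Set.Icc 0 a) := by
    refine monotoneOn_of_deriv_nonneg (convex_Icc 0 a) hgc.continuousOn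
      (fun s _ => (h.hasDerivAt_g s).differentiableAt.differentiableWithinAt) fun s hs => ?_
    rw [interior_Icc] at hs
    rw [(h.hasDerivAt_g s).deriv]
    have := hpos s hs.1.le hs.2
    have := h.w_pos s
    positivity
  have hf : MonotoneOn f (Set.Icc 0 a) := by
    refine monotoneOn_of_deriv_nonneg (convex_Icc 0 a) hfc.continuousOn
      (fun s _ => (h.hasDerivAt_f s).differentiableAt.differentiableWithinAt) fun s hs => ?_
    rw [interior_Icc] at hs
    rw [(h.hasDerivAt_f s).deriv]
    exact h.g_zero_nonneg.trans (hg ⟨le_rfl, ha0⟩ ⟨hs.1.le, hs.2.le⟩ hs.1.le)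
  have := hf ⟨le_rfl, ha0⟩ ⟨ha0, le_rfl⟩ ha0
  have := h.f_zero_pos
  have hfa : f a ≤ 0 := hfa
  linarith

lemma strictMonoOn_g (h : SpacelikeFlow m c f g w) : StrictMonoOn g (Set.Ici 0) := by
  refine strictMonoOn_of_deriv_pos (convex_Ici 0)
    (fun s _ => (h.hasDerivAt_g s).continuousAt.continuousWithinAt) fun s hs => ?_
  rw [interior_Ici] at hs
  rw [(h.hasDerivAt_g s).deriv]
  have := h.f_pos (le_of_lt hs)
  have := h.w_pos s
  positivity

lemma g_pos (h : SpacelikeFlow m c f g w) {t : ℝ} (ht : 0 < t) : 0 < g t :=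
  h.g_zero_nonneg.trans_lt (h.strictMonoOn_g Set.self_mem_Ici ht.le ht)

lemma strictMonoOn_f (h : SpacelikeFlow m c f g w) : StrictMonoOn f (Set.Ici 0) := by
  refine strictMonoOn_of_deriv_pos (convex_Ici 0)
    (fun s _ => (h.hasDerivAt_f s).continuousAt.continuousWithinAt) fun s hs => ?_
  rw [interior_Ici] at hs
  rw [(h.hasDerivAt_f s).deriv]
  exact h.g_pos hs

lemma tendsto_f (h : SpacelikeFlow m c f g w) : Tendsto f atTop atTop := by
  have hmono : MonotoneOn (fun t => f t - g 1 * t) (Set.Ici 1) := by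
    have hd : ∀ t, HasDerivAt (fun t => f t - g 1 * t) (g t - g 1) t := fun t => by
      refine ((h.hasDerivAt_f t).sub ((hasDerivAt_id t).const_mul (g 1))).congr_deriv ?_
      rw [mul_one]
    refine monotoneOn_of_deriv_nonneg (convex_Ici 1)
      (fun s _ => (hd s).continuousAt.continuousWithinAt)
      (fun s _ => (hd s).differentiableAt.differentiableWithinAt) fun s hs => ?_
    rw [interior_Ici, Set.mem_Ioi] at hs
    rw [(hd s).deriv, sub_nonneg]
    exact (h.strictMonoOn_g (Set.mem_Ici.2 zero_le_one) (Set.mem_Ici.2 (by linarith)) hs).le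
  refine tendsto_atTop_mono' atTop ?_ (tendsto_atTop_add_const_right atTop (f 1 - g 1 * 1)
    (tendsto_id.const_mul_atTop (h.g_pos one_pos)))
  filter_upwards [eventually_ge_atTop 1] with t ht
  have := hmono Set.self_mem_Ici ht ht
  simp only [id] at this ⊢
  linarith

lemma f_lt_w (h : SpacelikeFlow m c f g w) (hc : 0 < c) (t : ℝ) : f t < w t :=
  lt_of_pow_lt_pow_left₀ (m + 1) (h.w_pos t).le (by linarith [h.first_integral t])

lemma w_le_f (h : SpacelikeFlow m c f g w) (hc : c ≤ 0) {t : ℝ} (ht : 0 ≤ t) : w t ≤ f t :=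
  le_of_pow_le_pow_left₀ (n := m + 1) m.succ_ne_zero (h.f_pos ht).le (by linarith [h.first_integral t])

lemma w_lt_f (h : SpacelikeFlow m c f g w) (hc : c < 0) {t : ℝ} (ht : 0 ≤ t) : w t < f t :=
  lt_of_pow_lt_pow_left₀ (m + 1) (h.f_pos ht).le (by linarith [h.first_integral t])

lemma hasDerivAt_momentum (h : SpacelikeFlow m c f g w) (t : ℝ) :
    HasDerivAt (fun s => s - g s * w s) (1 - (f t / w t) ^ m) t := by
  refine ((hasDerivAt_id t).sub ((h.hasDerivAt_g t).mul (h.hasDerivAt_w t))).congr_deriv ?_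
  have hw := (h.w_pos t).ne'
  have hg : g t ^ 2 = 1 - (w t)⁻¹ ^ 2 := by
    have := h.w_sq t
    field_simp
    linarith
  have : f t ^ m * (w t)⁻¹ ^ (m + 3) * w t + g t * (g t * f t ^ m * (w t)⁻¹ ^ m) =
      f t ^ m * (w t)⁻¹ ^ m := by
    have h3 : (w t)⁻¹ ^ (m + 3) * w t = (w t)⁻¹ ^ m * (w t)⁻¹ ^ 2 := by
      rw [pow_add]; field_simp
    linear_combination f t ^ m * h3 + f t ^ m * (w t)⁻¹ ^ m * hg
  rw [this, div_eq_mul_inv, mul_pow]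

lemma momentum_le_w (h : SpacelikeFlow m c f g w) (t : ℝ) : g t * w t ≤ w t := by
  nlinarith [h.w_pos t, h.g_lt_one t]

lemma antitoneOn_momentum (h : SpacelikeFlow m c f g w) (hc : c ≤ 0) :
    AntitoneOn (fun s => s - g s * w s) (Set.Ici 0) := by
  refine antitoneOn_of_deriv_nonpos (convex_Ici 0)
    (fun s _ => (h.hasDerivAt_momentum s).continuousAt.continuousWithinAt)
    (fun s _ => (h.hasDerivAt_momentum s).differentiableAt.differentiableWithinAt) fun s hs => ?_
  rw [interior_Ici] at hs
  rw [(h.hasDerivAt_momentum s).deriv, sub_nonpos]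
  exact one_le_pow₀ ((one_le_div (h.w_pos s)).2 (h.w_le_f hc (le_of_lt hs)))

lemma strictAntiOn_momentum (h : SpacelikeFlow m c f g w) (hm : m ≠ 0) (hc : c < 0) :
    StrictAntiOn (fun s => s - g s * w s) (Set.Ici 0) := by
  refine strictAntiOn_of_deriv_neg (convex_Ici 0)
    (fun s _ => (h.hasDerivAt_momentum s).continuousAt.continuousWithinAt) fun s hs => ?_
  rw [interior_Ici] at hs
  rw [(h.hasDerivAt_momentum s).deriv, sub_neg]
  exact one_lt_pow₀ ((one_lt_div (h.w_pos s)).2 (h.w_lt_f hc (le_of_lt hs))) hm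

lemma strictMonoOn_momentum (h : SpacelikeFlow m c f g w) (hm : m ≠ 0) (hc : 0 < c) :
    StrictMonoOn (fun s => s - g s * w s) (Set.Ici 0) := by
  refine strictMonoOn_of_deriv_pos (convex_Ici 0)
    (fun s _ => (h.hasDerivAt_momentum s).continuousAt.continuousWithinAt) fun s hs => ?_
  rw [interior_Ici] at hs
  rw [(h.hasDerivAt_momentum s).deriv, sub_pos]
  have := h.w_pos s
  have := h.f_pos (le_of_lt hs)
  exact pow_lt_one₀ (by positivity) ((div_lt_one (h.w_pos s)).2 (h.f_lt_w hc s)) hm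

/-- Comparison with the hyperbola: for positive first integral, `f` reaches each height above `1`
faster than `√(1 + t²)`. -/
lemma strictAntiOn_delay (h : SpacelikeFlow m c f g w) (hc : 0 < c) {T : ℝ} (hT : 0 ≤ T)
    (hfT : 1 ≤ f T) : StrictAntiOn (fun s => s - √(f s ^ 2 - 1)) (Set.Ici T) := by
  have hfc : Continuous f := continuous_iff_continuousAt.2 fun s => (h.hasDerivAt_f s).continuousAt
  refine strictAntiOn_of_deriv_neg (convex_Ici T) (by fun_prop) fun s hs => ?_
  rw [interior_Ici, Set.mem_Ioi] at hs
  have hfs : 1 < f s :=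
    hfT.trans_lt (h.strictMonoOn_f (Set.mem_Ici.2 hT) (Set.mem_Ici.2 (by linarith)) hs)
  have hpos : 0 < f s ^ 2 - 1 := by nlinarith
  have hd := (hasDerivAt_id s).sub ((((h.hasDerivAt_f s).pow 2).sub_const 1).sqrt hpos.ne')
  have hS : 0 < √(f s ^ 2 - 1) := sqrt_pos.2 hpos
  have hgs : 0 < g s := h.g_pos (by linarith)
  have hlt : √(f s ^ 2 - 1) < f s * g s := by
    rw [sqrt_lt' (by positivity)]
    have hfw : f s ^ 2 < w s ^ 2 := by
      have := h.f_lt_w hc s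
      gcongr
    have hg1 : 0 < 1 - g s ^ 2 := by
      by_contra! hle
      nlinarith [h.w_sq s, sq_nonneg (w s)]
    nlinarith [h.w_sq s, mul_lt_mul_of_pos_right hfw hg1]
  refine lt_of_eq_of_lt hd.deriv ?_
  rw [sub_neg, lt_div_iff₀ (by positivity)]
  simp only [Pi.pow_apply]
  push_cast
  linarith

lemma sqrt_sq_sub_one_le {x : ℝ} (hx : 0 ≤ x) : √(x ^ 2 - 1) ≤ x :=
  (sqrt_le_sqrt (by linarith)).trans_eq (sqrt_sq hx)

lemma tendsto_w_sub_momentum (h : SpacelikeFlow m c f g w) (hc : 0 < c) :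
    Tendsto (fun t => w t - g t * w t) atTop (nhds 0) := by
  have hw : Tendsto w atTop atTop := tendsto_atTop_mono (fun t => (h.f_lt_w hc t).le) h.tendsto_f
  refine tendsto_of_tendsto_of_tendsto_of_le_of_le' tendsto_const_nhds
    (tendsto_inv_atTop_zero.comp hw) ?_ ?_
  · exact Eventually.of_forall fun t => sub_nonneg.2 (h.momentum_le_w t)
  · filter_upwards [eventually_gt_atTop 0] with t ht
    have hw := h.w_pos t
    have hg := h.g_pos ht
    have := h.w_sq t
    have := h.g_lt_one t
    simp only [Function.comp]
    rw [← one_div, le_div_iff₀ hw]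
    nlinarith [mul_pos (mul_pos hw hw) (mul_pos hg (sub_pos.2 this))]

lemma exists_tendsto_sub (h : SpacelikeFlow m c f g w) :
    ∃ lam, Tendsto (fun t => t - f t) atTop (nhds lam) := by
  have hmono : Monotone fun t => t - f t := by
    have hd : ∀ t, HasDerivAt (fun t => t - f t) (1 - g t) t := fun t =>
      (hasDerivAt_id t).sub (h.hasDerivAt_f t)
    refine monotone_of_deriv_nonneg (fun t => (hd t).differentiableAt) fun t => ?_
    rw [(hd t).deriv]
    linarith [h.g_lt_one t]
  suffices ∃ B, ∀ᶠ t in atTop, t - f t ≤ B by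
    obtain ⟨B, hB⟩ := this
    refine ⟨_, tendsto_atTop_ciSup hmono ⟨B, ?_⟩⟩
    rintro _ ⟨t, rfl⟩
    obtain ⟨s, hs, hts⟩ := (hB.and (eventually_ge_atTop t)).exists
    exact (hmono hts).trans hs
  rcases le_or_gt c 0 with hc | hc
  · refine ⟨0 - g 0 * w 0, ?_⟩
    filter_upwards [eventually_ge_atTop 0] with t ht
    have := h.antitoneOn_momentum hc Set.self_mem_Ici ht ht
    linarith [h.w_le_f hc ht, h.momentum_le_w t]
  · obtain ⟨T, hfT, hT⟩ :=
      ((h.tendsto_f.eventually_ge_atTop 1).and (eventually_ge_atTop 0)).exists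
    refine ⟨T - √(f T ^ 2 - 1), ?_⟩
    filter_upwards [eventually_ge_atTop T] with t ht
    have := (h.strictAntiOn_delay hc hT hfT).antitoneOn Set.self_mem_Ici ht ht
    linarith [sqrt_sq_sub_one_le (h.f_pos (hT.trans ht)).le]

variable {lam : ℝ}

lemma lam_neg_of_neg (h : SpacelikeFlow m c f g w) (hm : m ≠ 0) (hc : c < 0) (hg : g 0 = 0)
    (hl : Tendsto (fun t => t - f t) atTop (nhds lam)) : lam < 0 := by
  have hP := h.strictAntiOn_momentum hm hc
  have h1 := hP Set.self_mem_Ici (Set.mem_Ici.2 zero_le_one) one_pos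
  simp only [hg, zero_mul, sub_zero] at h1
  refine lt_of_le_of_lt (le_of_tendsto hl ?_) h1
  filter_upwards [eventually_ge_atTop 1] with t ht
  have ht0 : 0 ≤ t := by linarith
  have := hP.antitoneOn (Set.mem_Ici.2 zero_le_one) ht0 ht
  linarith [h.w_le_f hc.le ht0, h.momentum_le_w t]

lemma lam_pos_of_pos (h : SpacelikeFlow m c f g w) (hm : m ≠ 0) (hc : 0 < c) (hg : g 0 = 0)
    (hl : Tendsto (fun t => t - f t) atTop (nhds lam)) : 0 < lam := by
  have hP := h.strictMonoOn_momentum hm hc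
  have h1 := hP Set.self_mem_Ici (Set.mem_Ici.2 zero_le_one) one_pos
  simp only [hg, zero_mul, sub_zero] at h1
  have hl' := hl.add (h.tendsto_w_sub_momentum hc)
  rw [add_zero] at hl'
  refine lt_of_lt_of_le h1 (ge_of_tendsto hl' ?_)
  filter_upwards [eventually_ge_atTop 1] with t ht
  have := hP.monotoneOn (Set.mem_Ici.2 zero_le_one) (Set.mem_Ici.2 (by linarith)) ht
  linarith [h.f_lt_w hc t]

lemma lam_neg_of_f_zero_eq_one (h : SpacelikeFlow m c f g w) (hc : 0 < c) (hf : f 0 = 1)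
    (hl : Tendsto (fun t => t - f t) atTop (nhds lam)) : lam < 0 := by
  have hP := h.strictAntiOn_delay hc le_rfl hf.ge
  have h1 := hP Set.self_mem_Ici (Set.mem_Ici.2 zero_le_one) one_pos
  simp only [hf, one_pow, sub_self, sqrt_zero] at h1
  refine lt_of_le_of_lt (le_of_tendsto hl ?_) h1
  filter_upwards [eventually_ge_atTop 1] with t ht
  have ht0 : 0 ≤ t := by linarith
  have := hP.antitoneOn (Set.mem_Ici.2 zero_le_one) ht0 ht
  linarith [sqrt_sq_sub_one_le (h.f_pos ht0).le]

end SpacelikeFlow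

lemma tendsto_sqrt_one_add_sq_sub_self :
    Tendsto (fun t : ℝ => √(1 + t ^ 2) - t) atTop (nhds 0) := by
  refine tendsto_of_tendsto_of_tendsto_of_le_of_le' tendsto_const_nhds
    tendsto_inv_atTop_zero ?_ ?_
  · exact Eventually.of_forall fun t => sub_nonneg.2 (le_sqrt_of_sq_le (by linarith))
  · filter_upwards [eventually_gt_atTop 0] with t ht
    rw [sub_le_iff_le_add, sqrt_le_left (by positivity)]
    have : t⁻¹ * t = 1 := inv_mul_cancel₀ ht.ne'
    nlinarith [sq_nonneg t⁻¹]

/-- A global spacelike solution in first-order form. -/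
lemma IsGSS.spacelikeFlow {m : ℕ} {c : ℝ} {f : ℝ → ℝ} (hf : IsGSS (m + 1) f) (hf0 : 0 < f 0)
    (hg0 : 0 ≤ deriv f 0)
    (hc : (√(1 - deriv f 0 ^ 2))⁻¹ ^ (m + 1) = f 0 ^ (m + 1) + c) :
    SpacelikeFlow m c f (deriv f) (fun t => (√(1 - deriv f t ^ 2))⁻¹) := by
  obtain ⟨hC, hode⟩ := hf
  have hq : ∀ t, 0 < 1 - deriv f t ^ 2 := fun t => by
    have := (sq_lt_one_iff_abs_lt_one (deriv f t)).2 (hode t).1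
    linarith
  have hs : ∀ t, 0 < √(1 - deriv f t ^ 2) := fun t => sqrt_pos.2 (hq t)
  have hdf : ∀ t, HasDerivAt f (deriv f t) t := fun t =>
    (hC.differentiable two_ne_zero t).hasDerivAt
  have hC1 : ContDiff ℝ 1 (deriv f) := by
    have : ContDiff ℝ (1 + 1) f := by simpa [one_add_one_eq_two] using hC
    exact (contDiff_succ_iff_deriv.1 this).2.2
  have hdg : ∀ t, HasDerivAt (deriv f)
      (f t ^ m * ((√(1 - deriv f t ^ 2))⁻¹)⁻¹ ^ (m + 3)) t := fun t => by
    refine (hC1.differentiable one_ne_zero t).hasDerivAt.congr_deriv ?_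
    rw [(hode t).2, inv_inv, sqrt_eq_rpow, ← rpow_mul_natCast (hq t).le]
    congr 2
    push_cast
    ring
  have hdw : ∀ t, HasDerivAt (fun t => (√(1 - deriv f t ^ 2))⁻¹)
      (deriv f t * f t ^ m * ((√(1 - deriv f t ^ 2))⁻¹)⁻¹ ^ m) t := fun t => by
    refine (((((hdg t).pow 2).const_sub 1).sqrt (hq t).ne').inv (hs t).ne').congr_deriv ?_
    have := (hs t).ne'
    simp only [inv_inv, Pi.pow_apply]
    field_simp
    ring
  refine ⟨hdf, hdg, hdw, fun t => inv_pos.2 (hs t), fun t => ?_, fun t => (abs_lt.1 (hode t).1).2,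
    fun t => ?_, hf0, hg0⟩
  · rw [inv_pow, sq_sqrt (hq t).le, inv_mul_cancel₀ (hq t).ne']
  · have hd : ∀ t, HasDerivAt
        (fun t => (√(1 - deriv f t ^ 2))⁻¹ ^ (m + 1) - f t ^ (m + 1)) 0 t := fun t => by
      refine (((hdw t).pow (m + 1)).sub ((hdf t).pow (m + 1))).congr_deriv ?_
      have := (hs t).ne'
      simp only [inv_inv, Nat.add_sub_cancel, inv_pow]
      field_simp
      ring
    have := is_const_of_deriv_eq_zero (fun t => (hd t).differentiableAt)
      (fun t => (hd t).deriv) t 0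
    linarith

lemma IsFc.spacelikeFlow {m : ℕ} {c : ℝ} (hc : c ≤ 1) {f : ℝ → ℝ} (hf : IsFc (m + 1) c f) :
    SpacelikeFlow m c f (deriv f) (fun t => (√(1 - deriv f t ^ 2))⁻¹) := by
  obtain ⟨hG, hlt, heq⟩ := hf
  rcases hc.lt_or_eq with hc | rfl
  · obtain ⟨h0, h1⟩ := hlt hc
    refine hG.spacelikeFlow ?_ h1.ge ?_
    · rw [h0]
      exact rpow_pos_of_pos (by linarith) _
    · rw [h0, h1, one_div, rpow_inv_natCast_pow (by linarith) m.succ_ne_zero]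
      simp
  · obtain ⟨h0, h1⟩ := heq rfl
    refine hG.spacelikeFlow (h0 ▸ one_pos) (h1 ▸ sqrt_nonneg _) ?_
    have hle : (2 : ℝ) ^ (-(2 : ℝ) / (m + 1 : ℕ)) ≤ 1 :=
      rpow_le_one_of_one_le_of_nonpos one_le_two
        (div_nonpos_of_nonpos_of_nonneg (by norm_num) (Nat.cast_nonneg _))
    rw [h0, h1, sq_sqrt (by linarith), sub_sub_cancel, sqrt_eq_rpow,
      ← rpow_mul zero_le_two, ← rpow_neg zero_le_two, ← rpow_mul_natCast zero_le_two]
    have : -(-(2 : ℝ) / (m + 1 : ℕ) * (1 / 2)) * (m + 1 : ℕ) = 1 := by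
      have : ((m + 1 : ℕ) : ℝ) ≠ 0 := Nat.cast_ne_zero.2 m.succ_ne_zero
      field_simp
    rw [this]
    norm_num

/-- for every `c ≤ 1` the finite limit
`λ_c = lim_{t → +∞} (√(1+t²) - f_c t)` exists; it is negative for `c < 0`,
positive for `0 < c < 1`, and negative for `c = 1`. -/
theorem stmt_12 (n : ℕ) (hn : 2 ≤ n) (c : ℝ) (hc : c ≤ 1) (f : ℝ → ℝ)
    (hf : IsFc n c f) :
    ∃ lam : ℝ, Tendsto (fun t => Real.sqrt (1 + t ^ 2) - f t) atTop (nhds lam) ∧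
      (c < 0 → lam < 0) ∧ (0 < c → c < 1 → 0 < lam) ∧ (c = 1 → lam < 0) := by
  obtain ⟨m, rfl⟩ : ∃ m, n = m + 1 := ⟨n - 1, by omega⟩
  have hm : m ≠ 0 := by omega
  have h := hf.spacelikeFlow hc
  obtain ⟨lam, hl⟩ := h.exists_tendsto_sub
  refine ⟨lam, ?_, fun hc0 => ?_, fun hc0 hc1 => ?_, fun hc1 => ?_⟩
  · simpa using tendsto_sqrt_one_add_sq_sub_self.add hl
  · exact h.lam_neg_of_neg hm hc0 (hf.2.1 (by linarith)).2 hl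
  · exact h.lam_pos_of_pos hm hc0 (hf.2.1 hc1).2 hl
  · exact h.lam_neg_of_f_zero_eq_one (by linarith) (hf.2.2 hc1).1 hl
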